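/- arXiv:1804.03759 — 2 statements merged into one kernel-verified Lean document; each statement's English description precedes it below -/
import Mathlib

section
/- Let G = (𝒱, E) be a finite connected simple graph with a ZV-ordered partition ⟨Z, V_1, …, V_k⟩, and for i = 1,…,k let F_i be a mechanism on the induced subgraph G_i on V_i such that: F_i is anonymous and Pareto optimal; for infinitely many τ ∈ ℕ there exists a profile over V_i in which every location of V_i is voted for at least τ times and F_i returns R(V_i); and F_i is group-manipulation-resistant (as a mechanism on G_i). Then the mechanism F* is anonymous and Pareto optimal; and if moreover G is a ZV-line graph w.r.t. ⟨Z, V_1, …, V_k⟩, then F* is group-manipulation-resistant. -/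
/- Common framework: finite connected simple graphs, shortest-path distance,
   profiles as lists of vertices, mechanisms as functions `List α → α`,
   anonymity, Pareto optimality, and group-manipulation-resistance. -/

open Classical

noncomputable section

/-- The ball of radius `r` around `v`. -/
def ball {α : Type} (G : SimpleGraph α) (v : α) (r : ℕ) : Set α :=
  {u | G.dist v u ≤ r}

/-- Distance from a vertex to a (nonempty) set of vertices. -/
def distToSet {α : Type} (G : SimpleGraph α) (v : α) (Z : Finset α) : ℕ :=
  sInf ((fun z => G.dist v z) '' (Z : Set α))

/-- An agent located at `ℓ` weakly prefers `a` over `b`. -/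
def wPref {α : Type} (G : SimpleGraph α) (ℓ a b : α) : Prop := G.dist ℓ a ≤ G.dist ℓ b

/-- An agent located at `ℓ` strictly prefers `a` over `b`. -/
def sPref {α : Type} (G : SimpleGraph α) (ℓ a b : α) : Prop := G.dist ℓ a < G.dist ℓ b

/-- `u` Pareto dominates `v` w.r.t. the profile `x`. -/
def Dominates {α : Type} (G : SimpleGraph α) (x : List α) (u v : α) : Prop :=
  (∀ a ∈ x, wPref G a u v) ∧ (∃ a ∈ x, sPref G a u v)

/-- The set of Pareto optimal locations for a profile `x`. -/
def PO {α : Type} (G : SimpleGraph α) (x : List α) : Set α :=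
  {v | ¬ ∃ u, Dominates G x u v}

/-- A mechanism is anonymous if its outcome is invariant under permutations of ballots. -/
def Anonymous {α : Type} (F : List α → α) : Prop :=
  ∀ x y : List α, x.Perm y → F x = F y

/-- A mechanism is Pareto optimal if its outcome is always Pareto optimal. -/
def ParetoOptimal {α : Type} (G : SimpleGraph α) (F : List α → α) : Prop :=
  ∀ x : List α, F x ∈ PO G x

/-- The list of ballots `x j` for agents `j` outside the coalition `C`. -/
def profileMinus {α : Type} {n : ℕ} (x : Fin n → α) (C : Finset (Fin n)) : List α :=
  ((List.finRange n).filter (fun i => decide (i ∉ C))).map x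

/-- Group-manipulation-resistance where all sincere ballots and all manipulated
ballots are required to lie in the set `S`. -/
def GMRon {α : Type} (G : SimpleGraph α) (S : Set α) (F : List α → α) : Prop :=
  ¬ ∃ (n : ℕ) (x : Fin n → α) (C : Finset (Fin n)) (A : List α),
      (∀ i, x i ∈ S) ∧ (∀ a ∈ A, a ∈ S) ∧
      (∀ i ∈ C, wPref G (x i) (F (A ++ profileMinus x C)) (F (List.ofFn x))) ∧
      (∃ i ∈ C, sPref G (x i) (F (A ++ profileMinus x C)) (F (List.ofFn x)))

/-- Group-manipulation-resistance: no coalition `C` can, by replacing its ballots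
with an arbitrary finite tuple `A` of ballots (misreporting, false-name voting,
or abstaining), obtain an outcome that all its members weakly prefer and at least
one member strictly prefers. -/
def GMR {α : Type} (G : SimpleGraph α) (F : List α → α) : Prop :=
  ¬ ∃ (n : ℕ) (x : Fin n → α) (C : Finset (Fin n)) (A : List α),
      (∀ i ∈ C, wPref G (x i) (F (A ++ profileMinus x C)) (F (List.ofFn x))) ∧
      (∃ i ∈ C, sPref G (x i) (F (A ++ profileMinus x C)) (F (List.ofFn x)))

/-- `A` is an interval in `Z` (w.r.t. the order injection `ord`): it is a subset
of `Z` that is order-convex within `Z`. -/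
def IsIntervalIn {α : Type} (ord : α → ℝ) (Z : Finset α) (A : Set α) : Prop :=
  A ⊆ (Z : Set α) ∧
  ∀ a ∈ A, ∀ b ∈ A, ∀ c ∈ Z, ord a ≤ ord c → ord c ≤ ord b → c ∈ A

/-- A ZV-ordered partition ⟨Z, V₁, …, V_k⟩ of a connected graph `G`, together with
the order (injection into ℝ) on `Z` and the roots of the `Vᵢ`. -/
structure ZVPartition {α : Type} (G : SimpleGraph α) where
  hconn : G.Connected
  k : ℕ
  Z : Finset α
  Vs : Fin k → Finset α
  ord : α → ℝ
  Z_nonempty : Z.Nonempty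
  Vs_nonempty : ∀ i, (Vs i).Nonempty
  ord_inj : Set.InjOn ord (Z : Set α)
  Vs_disjoint : ∀ i j, i ≠ j → Disjoint (Vs i) (Vs j)
  cover : ∀ v : α, v ∈ Z ∨ ∃ i, v ∈ Vs i
  no_drop_Z : ¬ ∀ v : α, ∃ i, v ∈ Vs i
  no_drop_Vs : ∀ i : Fin k, ¬ ∀ v : α, v ∈ Z ∨ ∃ j, j ≠ i ∧ v ∈ Vs j
  root : Fin k → α
  root_mem : ∀ i, root i ∈ Vs i
  root_min : ∀ i, ∀ u ∈ Vs i, distToSet G (root i) Z ≤ distToSet G u Z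
  root_unique : ∀ i, ∀ u ∈ Vs i, (∀ w ∈ Vs i, distToSet G u Z ≤ distToSet G w Z) → u = root i
  separation : ∀ i : Fin k, ∀ u ∈ Vs i, ∀ v : α, v ∉ Vs i →
      ∀ p : G.Walk u v, root i ∈ p.support ∧ ∃ z ∈ Z, z ∈ p.support

/-- `G` is a ZV-line graph w.r.t. the ZV-ordered partition `P`: balls of radius 1
around Z-vertices meet `Z` in intervals, each induced subgraph on `Vᵢ` is
recursively a ZV-line graph whose Z-set contains the root of `Vᵢ` as its leftmost
element, and balls of radius 1 around the roots meet `Z` in intervals. -/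
inductive IsZVLineGraph : {β : Type} → {H : SimpleGraph β} → ZVPartition H → Prop
  | mk {β : Type} {H : SimpleGraph β} (P : ZVPartition H)
      (hb : ∀ z ∈ P.Z, IsIntervalIn P.ord P.Z (ball H z 1 ∩ (P.Z : Set β)))
      (Q : ∀ i : Fin P.k, ZVPartition (H.induce ((P.Vs i : Finset β) : Set β)))
      (hQ : ∀ i, IsZVLineGraph (Q i))
      (hroot : ∀ i : Fin P.k, ∃ h : P.root i ∈ ((P.Vs i : Finset β) : Set β),
          (⟨P.root i, h⟩ : ((P.Vs i : Finset β) : Set β)) ∈ (Q i).Z ∧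
          ∀ z ∈ (Q i).Z, (Q i).ord ⟨P.root i, h⟩ ≤ (Q i).ord z)
      (hballroot : ∀ i, IsIntervalIn P.ord P.Z (ball H (P.root i) 1 ∩ (P.Z : Set β))) :
      IsZVLineGraph P

/-- `F` is the mechanism `F*` determined by the ZV-ordered partition `P` and the
mechanisms `Fi` on the induced subgraphs: if all (at least one) ballots belong
to a common `Vᵢ`, return `Fᵢ` applied to the ballots; otherwise return the
leftmost Pareto optimal location in `Z`. -/
def IsFStar {α : Type} (G : SimpleGraph α) (P : ZVPartition G)
    (Fi : ∀ i : Fin P.k, List ((P.Vs i : Finset α) : Set α) → ((P.Vs i : Finset α) : Set α))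
    (F : List α → α) : Prop :=
  (∀ (x : List α) (i : Fin P.k), x ≠ [] →
      ∀ h : ∀ a ∈ x, a ∈ ((P.Vs i : Finset α) : Set α),
      F x = ↑(Fi i (x.pmap (fun a ha => ⟨a, ha⟩) h))) ∧
  (∀ x : List α, (¬ ∃ i : Fin P.k, x ≠ [] ∧ ∀ a ∈ x, a ∈ P.Vs i) →
      F x ∈ PO G x ∧ F x ∈ P.Z ∧ ∀ w ∈ P.Z, w ∈ PO G x → P.ord (F x) ≤ P.ord w)

/-- The number of ballots in the profile `x` that vote for the location `v`. -/
def voteCount {β : Type} (x : List β) (v : β) : ℕ :=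
  (x.map (fun w => if w = v then 1 else 0)).sum

namespace SimpleGraph.Connected

variable {α : Type} {G : SimpleGraph α}

/-- The second vertex on a geodesic. -/
theorem exists_adj_dist_add_one (hG : G.Connected) {u v : α} (huv : u ≠ v) :
    ∃ w, G.Adj u w ∧ G.dist w v + 1 = G.dist u v := by
  obtain ⟨p, hp⟩ := hG.exists_walk_length_eq_dist u v
  cases p with
  | nil => exact absurd rfl huv
  | @cons _ w _ h q =>
    refine ⟨w, h, ?_⟩
    have h1 : G.dist w v ≤ q.length := SimpleGraph.dist_le q
    have h2 := hG.dist_triangle (u := u) (v := w) (w := v)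
    have h3 := SimpleGraph.dist_eq_one_iff_adj.mpr h
    simp only [SimpleGraph.Walk.length_cons] at hp
    omega

end SimpleGraph.Connected

theorem dominates_trans {α : Type} {G : SimpleGraph α} {x : List α} {u v w : α}
    (huv : Dominates G x u v) (hvw : Dominates G x v w) : Dominates G x u w := by
  refine ⟨fun a ha => le_trans (huv.1 a ha) (hvw.1 a ha), ?_⟩
  obtain ⟨a, ha, h⟩ := huv.2
  exact ⟨a, ha, lt_of_lt_of_le h (hvw.1 a ha)⟩

/-- On a finite vertex set, a location dominated within `Z` is dominated by a location of `Z`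
that is itself not dominated within `Z`. -/
theorem exists_undominated_of_dominates {α : Type} {G : SimpleGraph α} {x : List α}
    {Z : Finset α} {u w : α} (hu : u ∈ Z) (huw : Dominates G x u w) :
    ∃ v ∈ Z, Dominates G x v w ∧ ¬ ∃ t ∈ Z, Dominates G x t v := by
  let r : Z → Z → Prop := fun a b => Dominates G x a b
  have : IsTrans Z r := ⟨fun _ _ _ => dominates_trans⟩
  have : Std.Irrefl r := ⟨fun a h => by
    obtain ⟨_, _, h⟩ := h.2
    exact lt_irrefl _ h⟩
  obtain ⟨v, hv, hmin⟩ := (Finite.wellFounded_of_trans_of_irrefl r).has_min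
    {a : Z | Dominates G x a w} ⟨⟨u, hu⟩, huw⟩
  exact ⟨v, v.2, hv, fun ⟨t, ht, htv⟩ => hmin ⟨t, ht⟩ (dominates_trans htv hv) htv⟩

theorem perm_mem_PO_iff {α : Type} {G : SimpleGraph α} {x y : List α} (h : x.Perm y) (v : α) :
    v ∈ PO G x ↔ v ∈ PO G y := by
  simp only [PO, Dominates, Set.mem_ofPred_eq, h.mem_iff]

theorem mem_profileMinus {α : Type} {n : ℕ} {x : Fin n → α} {C : Finset (Fin n)} {a : α} :
    a ∈ profileMinus x C ↔ ∃ i, i ∉ C ∧ x i = a := by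
  simp [profileMinus]

theorem profileMinus_comp {α β : Type} {n : ℕ} (f : α → β) (x : Fin n → α)
    (C : Finset (Fin n)) :
    profileMinus (fun i => f (x i)) C = (profileMinus x C).map f := by
  simp [profileMinus, Function.comp_def]

theorem count_profileMinus_le {α : Type} {n : ℕ} (x : Fin n → α) (C : Finset (Fin n)) (a : α) :
    (profileMinus x C).count a ≤ n := by
  refine List.count_le_length.trans ?_
  unfold profileMinus
  rw [List.length_map]
  exact (List.length_filter_le _ _).trans (by simp)

theorem voteCount_eq_count {β : Type} (x : List β) (v : β) : voteCount x v = x.count v := by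
  induction x with
  | nil => simp [voteCount]
  | cons a l ih =>
    simp only [voteCount, List.map_cons, List.sum_cons] at ih ⊢
    rw [ih, List.count_cons]
    by_cases h : a = v <;> simp [h, add_comm]

namespace ZVPartition

variable {α : Type} {G : SimpleGraph α} (P : ZVPartition G)

theorem dist_eq_via_root {i : Fin P.k} {u v : α} (hu : u ∈ P.Vs i) (hv : v ∉ P.Vs i) :
    G.dist u v = G.dist u (P.root i) + G.dist (P.root i) v := by
  obtain ⟨p, hp⟩ := P.hconn.exists_walk_length_eq_dist u v
  have hr := (P.separation i u hu v hv p).1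
  have h1 : (p.takeUntil _ hr).length + (p.dropUntil _ hr).length = p.length := by
    rw [← SimpleGraph.Walk.length_append, SimpleGraph.Walk.take_spec]
  have h2 := SimpleGraph.dist_le (p.takeUntil _ hr)
  have h3 := SimpleGraph.dist_le (p.dropUntil _ hr)
  have h4 := P.hconn.dist_triangle (u := u) (v := P.root i) (w := v)
  omega

theorem exists_not_mem_Vs (i : Fin P.k) : ∃ v, v ∉ P.Vs i := by
  by_contra! h
  exact P.no_drop_Z fun v => ⟨i, h v⟩

theorem mem_Vs_of_geodesic {i : Fin P.k} {u v w : α} (hu : u ∈ P.Vs i) (hv : v ∈ P.Vs i)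
    (h : G.dist u w + G.dist w v = G.dist u v) : w ∈ P.Vs i := by
  by_contra hw
  have h1 := P.dist_eq_via_root hu hw
  have h2 := P.dist_eq_via_root hv hw
  have h3 := P.hconn.dist_triangle (u := u) (v := P.root i) (w := v)
  have h4 : 0 < G.dist (P.root i) w :=
    P.hconn.pos_dist_of_ne fun h => hw (h ▸ P.root_mem i)
  rw [G.dist_comm (u := w)] at h
  rw [G.dist_comm (u := P.root i) (v := v)] at h3
  omega

/-- The parts `Vᵢ` are isometric subgraphs. -/
theorem dist_induce (i : Fin P.k) (u v : ((P.Vs i : Finset α) : Set α)) :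
    (G.induce ((P.Vs i : Finset α) : Set α)).dist u v = G.dist (u : α) v := by
  obtain ⟨p, hp⟩ := P.hconn.exists_walk_length_eq_dist (u : α) v
  have hs : ∀ w ∈ p.support, w ∈ ((P.Vs i : Finset α) : Set α) := by
    intro w hw
    refine P.mem_Vs_of_geodesic u.2 v.2 ?_
    have h1 : (p.takeUntil _ hw).length + (p.dropUntil _ hw).length = p.length := by
      rw [← SimpleGraph.Walk.length_append, SimpleGraph.Walk.take_spec]
    have h2 := SimpleGraph.dist_le (p.takeUntil _ hw)
    have h3 := SimpleGraph.dist_le (p.dropUntil _ hw)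
    have h4 := P.hconn.dist_triangle (u := (u : α)) (v := w) (w := v)
    omega
  have hmap := SimpleGraph.Walk.map_induce p hs
  have hlen : (p.induce _ hs).length = p.length := by
    have := congrArg SimpleGraph.Walk.length hmap
    rwa [SimpleGraph.Walk.length_map] at this
  apply le_antisymm
  · rw [← hp, ← hlen]
    exact SimpleGraph.dist_le _
  · obtain ⟨q, hq⟩ := (p.induce _ hs).reachable.exists_walk_length_eq_dist
    rw [← hq, ← SimpleGraph.Walk.length_map (SimpleGraph.Embedding.induce _).toHom q]
    exact SimpleGraph.dist_le _

theorem eq_root_of_mem_Z {i : Fin P.k} {u : α} (hu : u ∈ P.Vs i) (hZ : u ∈ P.Z) :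
    u = P.root i := by
  refine P.root_unique i u hu fun w _ => ?_
  have : distToSet G u P.Z = 0 :=
    Nat.sInf_eq_zero.mpr (Or.inl ⟨u, hZ, SimpleGraph.dist_self⟩)
  omega

theorem dist_eq_via_root_of_mem_Z {i : Fin P.k} {u v : α} (hu : u ∈ P.Vs i) (hv : v ∈ P.Z) :
    G.dist u v = G.dist u (P.root i) + G.dist (P.root i) v := by
  by_cases h : v ∈ P.Vs i
  · rw [P.eq_root_of_mem_Z h hv]; simp
  · exact P.dist_eq_via_root hu h

theorem exists_Z_adj_root {i : Fin P.k} {v : α} (hr : P.root i ∉ P.Z) (hv : v ∉ P.Vs i) :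
    ∃ z ∈ P.Z, G.Adj (P.root i) z ∧ G.dist v z + 1 = G.dist v (P.root i) := by
  have hne : P.root i ≠ v := fun h => hv (h ▸ P.root_mem i)
  obtain ⟨w, hw, hd⟩ := P.hconn.exists_adj_dist_add_one hne
  rw [G.dist_comm, G.dist_comm (u := P.root i)] at hd
  refine ⟨w, ?_, hw, hd⟩
  by_cases hwV : w ∈ P.Vs i
  · have := P.dist_eq_via_root hwV hv
    rw [G.dist_comm, G.dist_comm (u := P.root i)] at this
    omega
  · obtain ⟨z, hz, hzs⟩ := (P.separation i _ (P.root_mem i) w hwV hw.toWalk).2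
    simp at hzs
    rcases hzs with rfl | rfl
    · exact absurd hz hr
    · exact hz

/-- Distances from any vertex are quasi-convex along the order on `Z`. -/
def QuasiConvex : Prop :=
  ∀ ℓ : α, ∀ a ∈ P.Z, ∀ b ∈ P.Z, ∀ c ∈ P.Z, P.ord a ≤ P.ord c → P.ord c ≤ P.ord b →
    G.dist ℓ c ≤ max (G.dist ℓ a) (G.dist ℓ b)

/-- Vertices of `Z` and roots of the parts. -/
def IsCore (v : α) : Prop := v ∈ P.Z ∨ ∃ i, v = P.root i

variable {P}

/-- Going one step towards `v` along `Z`, through a core vertex `u`. -/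
theorem exists_step {v a : α} (hv : P.IsCore v) (ha : a ∈ P.Z) (h2 : 2 ≤ G.dist v a) :
    ∃ u, ∃ a' ∈ P.Z, P.IsCore u ∧ G.dist v u + 1 = G.dist v a ∧ G.dist u a ≤ 1 ∧
      G.dist u a' ≤ 1 ∧ G.dist v a' < G.dist v a := by
  have hne : a ≠ v := by rintro rfl; simp at h2
  obtain ⟨u, hau, hd⟩ := P.hconn.exists_adj_dist_add_one hne
  rw [G.dist_comm, G.dist_comm (u := a)] at hd
  have hua : G.dist u a = 1 := SimpleGraph.dist_eq_one_iff_adj.mpr hau.symm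
  by_cases hu : u ∈ P.Z
  · exact ⟨u, u, hu, Or.inl hu, hd, hua.le, by simp, by omega⟩
  obtain ⟨i, hi⟩ := (P.cover u).resolve_left hu
  have hur : u = P.root i := by
    have hvia := P.dist_eq_via_root_of_mem_Z hi ha
    by_contra hne'
    have hpos := P.hconn.pos_dist_of_ne hne'
    have har : P.root i = a := P.hconn.dist_eq_zero_iff.mp (by omega)
    have hvV : v ∉ P.Vs i := by
      intro hvV
      have : v = P.root i := by
        rcases hv with hv | ⟨j, rfl⟩
        · exact P.eq_root_of_mem_Z hvV hv
        · by_cases hij : j = i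
          · rw [hij]
          · exact absurd hvV (Finset.disjoint_left.mp (P.Vs_disjoint j i hij) (P.root_mem j))
      exact hne (by rw [this, har])
    have := P.dist_eq_via_root hi hvV
    rw [har, G.dist_comm, G.dist_comm (u := a)] at this
    omega
  subst hur
  have hvV : v ∉ P.Vs i := by
    intro hvV
    rcases hv with hv | ⟨j, rfl⟩
    · exact hu (P.eq_root_of_mem_Z hvV hv ▸ hv)
    · by_cases hij : j = i
      · subst hij; simp at hd; omega
      · exact absurd hvV (Finset.disjoint_left.mp (P.Vs_disjoint j i hij) (P.root_mem j))
  obtain ⟨z, hz, hadj, hdz⟩ := P.exists_Z_adj_root hu hvV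
  exact ⟨_, z, hz, Or.inr ⟨i, rfl⟩, hd, hua.le,
    (SimpleGraph.dist_eq_one_iff_adj.mpr hadj).le, by omega⟩

theorem dist_le_of_between
    (hball : ∀ v, P.IsCore v → IsIntervalIn P.ord P.Z (ball G v 1 ∩ (P.Z : Set α)))
    {v : α} (hv : P.IsCore v) (r : ℕ) :
    ∀ a ∈ P.Z, ∀ b ∈ P.Z, ∀ c ∈ P.Z, G.dist v a ≤ r → G.dist v b ≤ r →
      P.ord a ≤ P.ord c → P.ord c ≤ P.ord b → G.dist v c ≤ r := by
  have hone : ∀ u, P.IsCore u → ∀ a ∈ P.Z, ∀ b ∈ P.Z, ∀ c ∈ P.Z, G.dist u a ≤ 1 →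
      G.dist u b ≤ 1 → P.ord a ≤ P.ord c → P.ord c ≤ P.ord b → G.dist u c ≤ 1 :=
    fun u hu a ha b hb c hc hua hub h1 h2 =>
      ((hball u hu).2 a ⟨hua, ha⟩ b ⟨hub, hb⟩ c hc h1 h2).1
  induction r with
  | zero =>
    intro a ha b hb c hc hva hvb h1 h2
    have e1 := P.hconn.dist_eq_zero_iff.mp (Nat.le_zero.mp hva)
    have e2 := P.hconn.dist_eq_zero_iff.mp (Nat.le_zero.mp hvb)
    subst e1 e2
    rw [P.ord_inj hc ha (le_antisymm h2 h1)]
    simp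
  | succ r ih =>
    intro a ha b hb c hc hva hvb h1 h2
    rcases Nat.eq_zero_or_pos r with rfl | hr
    · exact hone v hv a ha b hb c hc hva hvb h1 h2
    have key : ∀ a ∈ P.Z, G.dist v a ≤ r + 1 → ∃ a' ∈ P.Z, G.dist v a' ≤ r ∧ ∀ c ∈ P.Z,
        (P.ord a ≤ P.ord c ∧ P.ord c ≤ P.ord a' ∨ P.ord a' ≤ P.ord c ∧ P.ord c ≤ P.ord a) →
        G.dist v c ≤ r + 1 := by
      intro a ha hva
      by_cases hlt : G.dist v a ≤ r
      · refine ⟨a, ha, hlt, fun c hc h => ?_⟩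
        have : P.ord c = P.ord a := by
          rcases h with h | h <;> exact le_antisymm (by tauto) (by tauto)
        rw [P.ord_inj hc ha this]
        omega
      · obtain ⟨u, a', ha', hu, hd, hua, hua', hlt'⟩ := exists_step hv ha (by omega)
        refine ⟨a', ha', by omega, fun c hc h => ?_⟩
        have huc : G.dist u c ≤ 1 := by
          rcases h with h | h
          · exact hone u hu a ha a' ha' c hc hua hua' h.1 h.2
          · exact hone u hu a' ha' a ha c hc hua' hua h.1 h.2
        have := P.hconn.dist_triangle (u := v) (v := u) (w := c)
        omega
    obtain ⟨a', ha', hva', hA⟩ := key a ha hva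
    obtain ⟨b', hb', hvb', hB⟩ := key b hb hvb
    rcases le_total (P.ord c) (P.ord a') with h3 | h3
    · exact hA c hc (Or.inl ⟨h1, h3⟩)
    rcases le_total (P.ord b') (P.ord c) with h4 | h4
    · exact hB c hc (Or.inr ⟨h4, h2⟩)
    exact (ih a' ha' b' hb' c hc hva' hvb' h3 h4).trans (Nat.le_succ r)

theorem quasiConvex_of_isZVLineGraph (h : IsZVLineGraph P) : P.QuasiConvex := by
  have hball : ∀ v, P.IsCore v → IsIntervalIn P.ord P.Z (ball G v 1 ∩ (P.Z : Set α)) := by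
    cases h with
    | mk _ hb _ _ _ hballroot =>
      rintro v (hv | ⟨i, rfl⟩)
      · exact hb v hv
      · exact hballroot i
  have hcore : ∀ v, P.IsCore v → ∀ a ∈ P.Z, ∀ b ∈ P.Z, ∀ c ∈ P.Z, P.ord a ≤ P.ord c →
      P.ord c ≤ P.ord b → G.dist v c ≤ max (G.dist v a) (G.dist v b) :=
    fun v hv a ha b hb c hc =>
      dist_le_of_between hball hv _ a ha b hb c hc (le_max_left _ _) (le_max_right _ _)
  intro ℓ a ha b hb c hc h1 h2
  rcases P.cover ℓ with hℓ | ⟨i, hi⟩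
  · exact hcore ℓ (Or.inl hℓ) a ha b hb c hc h1 h2
  · have := hcore _ (Or.inr ⟨i, rfl⟩) a ha b hb c hc h1 h2
    rw [P.dist_eq_via_root_of_mem_Z hi ha, P.dist_eq_via_root_of_mem_Z hi hb,
      P.dist_eq_via_root_of_mem_Z hi hc]
    omega

/-- If not all ballots lie in a common part, the leftmost location of `Z` that is not dominated
by a location of `Z` is Pareto optimal. -/
theorem mem_PO_of_leftmost (hq : P.QuasiConvex) {x : List α}
    (hx : x ≠ [] → ∀ i, ∃ a ∈ x, a ∉ P.Vs i) {z : α} (hz : z ∈ P.Z)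
    (hund : ¬ ∃ u ∈ P.Z, Dominates G x u z)
    (hleft : ∀ w ∈ P.Z, (¬ ∃ u ∈ P.Z, Dominates G x u w) → P.ord z ≤ P.ord w) :
    z ∈ PO G x := by
  rintro ⟨u, hu⟩
  have hne : x ≠ [] := by
    obtain ⟨a, ha, -⟩ := hu.2
    exact List.ne_nil_of_mem ha
  have huZ : u ∉ P.Z := fun h => hund ⟨u, h, hu⟩
  obtain ⟨i, hi⟩ := (P.cover u).resolve_left huZ
  obtain ⟨b, hb, hbV⟩ := hx hne i
  have hout : ∀ a ∈ x, a ∉ P.Vs i →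
      G.dist a (P.root i) + G.dist u (P.root i) ≤ G.dist a z := by
    intro a ha haV
    have h1 : G.dist a u ≤ G.dist a z := hu.1 a ha
    rw [G.dist_comm, P.dist_eq_via_root hi haV, G.dist_comm (u := P.root i)] at h1
    omega
  by_cases hr : P.root i ∈ P.Z
  · have hpos : 0 < G.dist u (P.root i) := P.hconn.pos_dist_of_ne fun h => huZ (h ▸ hr)
    refine hund ⟨_, hr, fun a ha => ?_, b, hb, ?_⟩
    · by_cases haV : a ∈ P.Vs i
      · have := P.dist_eq_via_root_of_mem_Z haV hz
        unfold wPref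
        omega
      · have := hout a ha haV
        unfold wPref
        omega
    · have := hout b hb hbV
      unfold sPref
      omega
  · let T := P.Z.filter fun t => G.Adj (P.root i) t ∧ ∃ a ∈ x, G.dist a t < G.dist a z
    have hT : ∀ a ∈ x, a ∉ P.Vs i → ∃ t ∈ T, G.dist a t < G.dist a z := by
      intro a ha haV
      obtain ⟨t, ht, hadj, hd⟩ := P.exists_Z_adj_root hr haV
      have := hout a ha haV
      exact ⟨t, by simpa [T] using ⟨ht, hadj, a, ha, by omega⟩, by omega⟩
    have hright : ∀ t ∈ T, P.ord z ≤ P.ord t := by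
      intro t ht
      simp only [T, Finset.mem_filter] at ht
      obtain ⟨htZ, -, a, ha, hlt⟩ := ht
      by_contra! hlt'
      have hdom : ∃ s ∈ P.Z, Dominates G x s t := by
        by_contra hdom
        exact absurd (hleft t htZ hdom) (not_le.mpr hlt')
      obtain ⟨s, hs, hst⟩ := hdom
      obtain ⟨v, hv, hvt, hvu⟩ := exists_undominated_of_dominates hs hst
      have h1 := hq a t htZ v hv z hz hlt'.le (hleft v hv hvu)
      have h2 : G.dist a v ≤ G.dist a t := hvt.1 a ha
      omega
    obtain ⟨t₀, ht₀, -⟩ := hT b hb hbV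
    obtain ⟨v, hv, hmin⟩ := T.exists_min_image P.ord ⟨t₀, ht₀⟩
    have hv' := hv
    simp only [T, Finset.mem_filter] at hv'
    obtain ⟨hvZ, hadj, c, hc, hlt⟩ := hv'
    refine hund ⟨v, hvZ, fun a ha => ?_, c, hc, hlt⟩
    by_cases haV : a ∈ P.Vs i
    · have h1 := P.dist_eq_via_root_of_mem_Z haV hz
      have h2 := P.dist_eq_via_root_of_mem_Z haV hvZ
      have h3 : 0 < G.dist (P.root i) z := P.hconn.pos_dist_of_ne fun h => hr (h ▸ hz)
      have h4 := SimpleGraph.dist_eq_one_iff_adj.mpr hadj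
      unfold wPref
      omega
    · obtain ⟨t, ht, hta⟩ := hT a ha haV
      have htZ : t ∈ P.Z := (Finset.mem_filter.mp ht).1
      have := hq a z hz t htZ v hvZ (hright v hv) (hmin t ht)
      unfold wPref
      omega

/-- If not all ballots lie in a common part, everyone weakly prefers the leftmost Pareto optimal
location of `Z` to every location of `Z` on its left. -/
theorem wPref_of_ord_lt (hq : P.QuasiConvex) {x : List α}
    (hx : x ≠ [] → ∀ i, ∃ a ∈ x, a ∉ P.Vs i) {z : α} (hzPO : z ∈ PO G x) (hz : z ∈ P.Z)
    (hleft : ∀ w ∈ P.Z, w ∈ PO G x → P.ord z ≤ P.ord w) {w : α} (hw : w ∈ P.Z)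
    (hlt : P.ord w < P.ord z) {a : α} (ha : a ∈ x) : wPref G a z w := by
  let S := P.Z.filter fun t => ¬ ∃ u ∈ P.Z, Dominates G x u t
  have hzS : z ∈ S := Finset.mem_filter.mpr ⟨hz, fun ⟨u, _, hu⟩ => hzPO ⟨u, hu⟩⟩
  obtain ⟨z₀, hz₀, hmin⟩ := S.exists_min_image P.ord ⟨z, hzS⟩
  have hz₀' := Finset.mem_filter.mp hz₀
  have hzz₀ : P.ord z ≤ P.ord z₀ := hleft z₀ hz₀'.1 <|
    mem_PO_of_leftmost hq hx hz₀'.1 hz₀'.2 fun w hw h => hmin w (Finset.mem_filter.mpr ⟨hw, h⟩)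
  have hdom : ∃ u ∈ P.Z, Dominates G x u w := by
    by_contra h
    have := hmin w (Finset.mem_filter.mpr ⟨hw, h⟩)
    linarith
  obtain ⟨u, hu, huw⟩ := hdom
  obtain ⟨v, hv, hvw, hvu⟩ := exists_undominated_of_dominates hu huw
  have h1 := hmin v (Finset.mem_filter.mpr ⟨hv, hvu⟩)
  have h2 := hq a w hw v hv z hz hlt.le (by linarith)
  have h3 : G.dist a v ≤ G.dist a w := hvw.1 a ha
  unfold wPref
  omega

end ZVPartition

namespace IsFStar

variable {α : Type} {G : SimpleGraph α} {P : ZVPartition G}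
  {Fi : ∀ i : Fin P.k, List ((P.Vs i : Finset α) : Set α) → ((P.Vs i : Finset α) : Set α)}
  {F : List α → α}

theorem apply_map_val (hF : IsFStar G P Fi F) {i : Fin P.k}
    {l : List ((P.Vs i : Finset α) : Set α)} (hl : l ≠ []) :
    F (l.map Subtype.val) = Fi i l := by
  have h : ∀ a ∈ l.map Subtype.val, a ∈ ((P.Vs i : Finset α) : Set α) := by
    simp only [List.mem_map]
    rintro _ ⟨b, -, rfl⟩
    exact b.2
  rw [hF.1 _ i (mt List.map_eq_nil_iff.mp hl) h]
  congr 2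
  rw [List.pmap_map]
  simp

theorem anonymous (hF : IsFStar G P Fi F) (hanon : ∀ i, Anonymous (Fi i)) : Anonymous F := by
  intro x y hxy
  by_cases hx : ∃ i : Fin P.k, x ≠ [] ∧ ∀ a ∈ x, a ∈ P.Vs i
  · obtain ⟨i, hne, hi⟩ := hx
    have hi' : ∀ a ∈ y, a ∈ P.Vs i := fun a ha => hi a (hxy.mem_iff.mpr ha)
    rw [hF.1 x i hne hi, hF.1 y i (fun h => hne (by simpa [h] using hxy)) hi']
    exact congrArg _ (hanon i _ _ (hxy.pmap _))
  · have hy : ¬ ∃ i : Fin P.k, y ≠ [] ∧ ∀ a ∈ y, a ∈ P.Vs i := by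
      rintro ⟨i, hne, hi⟩
      exact hx ⟨i, fun h => hne (by simpa [h] using hxy.symm),
        fun a ha => hi a (hxy.mem_iff.mp ha)⟩
    obtain ⟨h1, h2, h3⟩ := hF.2 x hx
    obtain ⟨h4, h5, h6⟩ := hF.2 y hy
    exact P.ord_inj h2 h5 (le_antisymm (h3 _ h5 ((perm_mem_PO_iff hxy _).mpr h4))
      (h6 _ h2 ((perm_mem_PO_iff hxy _).mp h1)))

theorem paretoOptimal (hF : IsFStar G P Fi F)
    (hpo : ∀ i, ParetoOptimal (G.induce ((P.Vs i : Finset α) : Set α)) (Fi i)) :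
    ParetoOptimal G F := by
  intro x
  by_cases hx : ∃ i : Fin P.k, x ≠ [] ∧ ∀ a ∈ x, a ∈ P.Vs i
  · obtain ⟨i, hne, hi⟩ := hx
    lift x to List ((P.Vs i : Finset α) : Set α) using hi
    have hne' : x ≠ [] := fun h => hne (by rw [h]; rfl)
    rw [hF.apply_map_val hne']
    have hin : ∀ u : ((P.Vs i : Finset α) : Set α),
        ¬ Dominates G (x.map Subtype.val) u (Fi i x) := by
      intro u hu
      refine hpo i x ⟨u, fun a ha => ?_, ?_⟩
      · have := hu.1 a (List.mem_map_of_mem ha)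
        unfold wPref at this ⊢
        rwa [P.dist_induce, P.dist_induce]
      · obtain ⟨_, ha, h⟩ := hu.2
        obtain ⟨a, hax, rfl⟩ := List.mem_map.mp ha
        refine ⟨a, hax, ?_⟩
        unfold sPref at h ⊢
        rwa [P.dist_induce, P.dist_induce]
    rintro ⟨u, hu⟩
    by_cases huV : u ∈ P.Vs i
    · exact hin ⟨u, huV⟩ hu
    · have hlt : ∀ a ∈ x.map Subtype.val, G.dist a (P.root i) < G.dist a u := by
        intro a ha
        obtain ⟨a, -, rfl⟩ := List.mem_map.mp ha
        have h1 := P.dist_eq_via_root a.2 huV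
        have h2 : 0 < G.dist (P.root i) u :=
          P.hconn.pos_dist_of_ne fun h => huV (h ▸ P.root_mem i)
        omega
      refine hin ⟨P.root i, P.root_mem i⟩ ⟨fun a ha => ?_, ?_⟩
      · exact (hlt a ha).le.trans (hu.1 a ha)
      · obtain ⟨a, ha, h⟩ := hu.2
        exact ⟨a, ha, (hlt a ha).trans h⟩
  · exact (hF.2 x hx).1

end IsFStar

/-- A coalition can always complete the remaining ballots to a profile electing the root. -/
theorem exists_ballots_apply_eq {β : Type} {F : List β → β} (hanon : Anonymous F) {r : β}
    (hτ : {τ : ℕ | ∃ x : List β, (∀ v, τ ≤ voteCount x v) ∧ F x = r}.Infinite)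
    {n : ℕ} (x : Fin n → β) (C : Finset (Fin n)) :
    ∃ A : List β, F (A ++ profileMinus x C) = r := by
  obtain ⟨τ, ⟨t, ht, htr⟩, hn⟩ := hτ.exists_gt n
  have hsub : (profileMinus x C).Subperm t := by
    rw [List.subperm_ext_iff]
    intro a _
    have h1 := count_profileMinus_le x C a
    have h2 := ht a
    rw [voteCount_eq_count] at h2
    omega
  obtain ⟨l, hl, hlt⟩ := hsub
  obtain ⟨A, hA⟩ := hlt.exists_perm_append
  refine ⟨A, ?_⟩
  rw [← htr]
  exact hanon _ _ (List.perm_append_comm.trans ((hl.symm.append_right A).trans hA.symm))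

namespace IsFStar

variable {α : Type} {G : SimpleGraph α} {P : ZVPartition G}
  {Fi : ∀ i : Fin P.k, List ((P.Vs i : Finset α) : Set α) → ((P.Vs i : Finset α) : Set α)}
  {F : List α → α}

/-- A coalition cannot gain when all sincere ballots lie in a common part. -/
theorem not_manipulable_of_forall_mem (hF : IsFStar G P Fi F)
    (hanon : ∀ i, Anonymous (Fi i))
    (hτ : ∀ i, {τ : ℕ | ∃ x : List ((P.Vs i : Finset α) : Set α),
        (∀ v : ((P.Vs i : Finset α) : Set α), τ ≤ voteCount x v) ∧
        Fi i x = ⟨P.root i, Finset.mem_coe.mpr (P.root_mem i)⟩}.Infinite)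
    (hgmr : ∀ i, GMR (G.induce ((P.Vs i : Finset α) : Set α)) (Fi i))
    {i : Fin P.k} {n : ℕ} {x : Fin n → α} {C : Finset (Fin n)} {A : List α}
    (hi : ∀ j, x j ∈ P.Vs i)
    (hw : ∀ j ∈ C, wPref G (x j) (F (A ++ profileMinus x C)) (F (List.ofFn x))) :
    ¬ ∃ j ∈ C, sPref G (x j) (F (A ++ profileMinus x C)) (F (List.ofFn x)) := by
  rintro ⟨j₀, hj₀, hs⟩
  obtain ⟨x', rfl⟩ : ∃ x' : Fin n → ((P.Vs i : Finset α) : Set α), x = fun j => (x' j : α) :=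
    ⟨fun j => ⟨x j, hi j⟩, rfl⟩
  have hne : List.ofFn x' ≠ [] := List.ne_nil_of_mem (List.mem_ofFn.mpr ⟨j₀, rfl⟩)
  have hFx : F (List.ofFn fun j => (x' j : α)) = Fi i (List.ofFn x') := by
    rw [← hF.apply_map_val hne, List.map_ofFn]
    rfl
  rw [hFx] at hw hs
  set y := A ++ profileMinus (fun j => (x' j : α)) C with hy
  have hind : ∀ B : List ((P.Vs i : Finset α) : Set α),
      (∀ j ∈ C, G.dist (x' j : α) (Fi i (B ++ profileMinus x' C)) ≤ G.dist (x' j : α) (F y)) →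
      False := by
    intro B hB
    refine hgmr i ⟨n, x', C, B, fun j hj => ?_, j₀, hj₀, ?_⟩
    · unfold wPref
      rw [P.dist_induce, P.dist_induce]
      exact (hB j hj).trans (hw j hj)
    · unfold sPref
      rw [P.dist_induce, P.dist_induce]
      exact (hB j₀ hj₀).trans_lt hs
  by_cases hyV : y ≠ [] ∧ ∀ a ∈ y, a ∈ P.Vs i
  · obtain ⟨hyne, hyV⟩ := hyV
    have hAV : ∀ a ∈ A, a ∈ ((P.Vs i : Finset α) : Set α) :=
      fun a ha => hyV a (List.mem_append_left _ ha)
    lift A to List ((P.Vs i : Finset α) : Set α) using hAV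
    have hy' : y = (A ++ profileMinus x' C).map Subtype.val := by
      rw [hy, profileMinus_comp, List.map_append]
    refine hind A fun j _ => ?_
    rw [hy', hF.apply_map_val]
    intro h
    exact hyne (by rw [hy', h]; rfl)
  · obtain ⟨B, hB⟩ := exists_ballots_apply_eq (hanon i) (hτ i) x' C
    refine hind B fun j _ => ?_
    rw [hB]
    have hout : F y ∉ P.Vs i ∨ F y ∈ P.Z := by
      by_cases hy2 : ∃ k : Fin P.k, y ≠ [] ∧ ∀ a ∈ y, a ∈ P.Vs k
      · obtain ⟨k, hyne, hk⟩ := hy2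
        left
        rw [hF.1 y k hyne hk]
        intro hmem
        by_cases hki : k = i
        · subst hki; exact hyV ⟨hyne, hk⟩
        · exact Finset.disjoint_left.mp (P.Vs_disjoint k i hki) (Subtype.property _) hmem
      · exact Or.inr (hF.2 y hy2).2.1
    have : G.dist (x' j : α) (F y) = G.dist (x' j : α) (P.root i) + G.dist (P.root i) (F y) := by
      rcases hout with h | h
      · exact P.dist_eq_via_root (x' j).2 h
      · exact P.dist_eq_via_root_of_mem_Z (x' j).2 h
    simp only
    omega

/-- A coalition cannot gain when the sincere ballots do not lie in a common part. -/
theorem not_manipulable_of_not_forall_mem (hF : IsFStar G P Fi F) (hq : P.QuasiConvex)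
    {n : ℕ} {x : Fin n → α} {C : Finset (Fin n)} {A : List α}
    (hx : ∀ i, ∃ j, x j ∉ P.Vs i)
    (hw : ∀ j ∈ C, wPref G (x j) (F (A ++ profileMinus x C)) (F (List.ofFn x))) :
    ¬ ∃ j ∈ C, sPref G (x j) (F (A ++ profileMinus x C)) (F (List.ofFn x)) := by
  rintro ⟨j₀, hj₀, hs⟩
  have hnot : ¬ ∃ i : Fin P.k, List.ofFn x ≠ [] ∧ ∀ a ∈ List.ofFn x, a ∈ P.Vs i := by
    rintro ⟨i, -, hi⟩
    obtain ⟨j, hj⟩ := hx i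
    exact hj (hi _ (List.mem_ofFn.mpr ⟨j, rfl⟩))
  have hx' : List.ofFn x ≠ [] → ∀ i, ∃ a ∈ List.ofFn x, a ∉ P.Vs i := fun _ i =>
    (hx i).imp' x fun j hj => ⟨List.mem_ofFn.mpr ⟨j, rfl⟩, hj⟩
  obtain ⟨hzPO, hz, hzleft⟩ := hF.2 _ hnot
  set z := F (List.ofFn x) with hzdef
  set y := A ++ profileMinus x C with hy
  have hnodom : ∀ u, (∀ j, G.dist (x j) u ≤ G.dist (x j) z) →
      ¬ ∃ j, G.dist (x j) u < G.dist (x j) z := by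
    rintro u hu ⟨j, hj⟩
    refine hzPO ⟨u, fun a ha => ?_, x j, List.mem_ofFn.mpr ⟨j, rfl⟩, hj⟩
    obtain ⟨j, rfl⟩ := List.mem_ofFn.mp ha
    exact hu j
  by_cases hyV : ∃ i : Fin P.k, y ≠ [] ∧ ∀ a ∈ y, a ∈ P.Vs i
  · obtain ⟨i, hyne, hi⟩ := hyV
    have hwV : F y ∈ P.Vs i := by
      rw [hF.1 y i hyne hi]
      exact Subtype.property _
    have hout : ∀ j, x j ∉ P.Vs i →
        j ∈ C ∧ G.dist (x j) (F y) = G.dist (x j) (P.root i) + G.dist (P.root i) (F y) := by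
      intro j hj
      refine ⟨?_, ?_⟩
      · by_contra hjC
        exact hj (hi _ (List.mem_append_right _ (mem_profileMinus.mpr ⟨j, hjC, rfl⟩)))
      · rw [G.dist_comm, P.dist_eq_via_root hwV hj, G.dist_comm (u := P.root i),
          G.dist_comm (u := F y), add_comm]
    have hle : ∀ j, G.dist (x j) (P.root i) ≤ G.dist (x j) z := by
      intro j
      by_cases hj : x j ∈ P.Vs i
      · have := P.dist_eq_via_root_of_mem_Z hj hz
        omega
      · obtain ⟨hjC, hd⟩ := hout j hj
        have : G.dist (x j) (F y) ≤ G.dist (x j) z := hw j hjC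
        omega
    have heq := hnodom _ hle
    push Not at heq
    obtain ⟨j₁, hj₁⟩ := hx i
    obtain ⟨hj₁C, hd⟩ := hout j₁ hj₁
    have h1 : G.dist (x j₁) (F y) ≤ G.dist (x j₁) z := hw j₁ hj₁C
    have h2 := heq j₁
    have hroot : P.root i = F y := P.hconn.dist_eq_zero_iff.mp (by omega)
    have h3 := heq j₀
    have h4 : G.dist (x j₀) (F y) < G.dist (x j₀) z := hs
    rw [← hroot] at h4
    omega
  · have hy' : y ≠ [] → ∀ i, ∃ a ∈ y, a ∉ P.Vs i := by
      intro hne i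
      by_contra! h
      exact hyV ⟨i, hne, h⟩
    obtain ⟨hwPO, hwZ, hwleft⟩ := hF.2 _ hyV
    rcases lt_trichotomy (P.ord (F y)) (P.ord z) with hlt | heq | hgt
    · have : G.dist (x j₀) z ≤ G.dist (x j₀) (F y) :=
        ZVPartition.wPref_of_ord_lt hq hx' hzPO hz hzleft hwZ hlt
          (List.mem_ofFn.mpr ⟨j₀, rfl⟩)
      exact absurd hs (not_lt.mpr this)
    · rw [P.ord_inj hwZ hz heq] at hs
      exact lt_irrefl _ hs
    · refine hnodom (F y) (fun j => ?_) ⟨j₀, hs⟩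
      by_cases hj : j ∈ C
      · exact hw j hj
      · exact ZVPartition.wPref_of_ord_lt hq hy' hwPO hwZ hwleft hz hgt
          (List.mem_append_right _ (mem_profileMinus.mpr ⟨j, hj, rfl⟩))

end IsFStar

/-- Let `G` be a finite connected graph with a ZV-ordered
partition `P`, and for each `i` let `Fi i` be a mechanism on the induced subgraph
`Gᵢ` that is anonymous, Pareto optimal, returns the root `R(Vᵢ)` on profiles
where every location of `Vᵢ` is voted for at least `τ` times (for infinitely many
`τ`), and is group-manipulation-resistant. Then any mechanism `F*` determined by
this data is anonymous and Pareto optimal; and if moreover `G` is a ZV-line graph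
w.r.t. `P`, then `F*` is group-manipulation-resistant. -/
theorem fstar_of_good_subgraph_mechanisms
    {α : Type} [Fintype α] (G : SimpleGraph α) (P : ZVPartition G)
    (Fi : ∀ i : Fin P.k, List ((P.Vs i : Finset α) : Set α) → ((P.Vs i : Finset α) : Set α))
    (hanon : ∀ i, Anonymous (Fi i))
    (hpo : ∀ i, ParetoOptimal (G.induce ((P.Vs i : Finset α) : Set α)) (Fi i))
    (hτ : ∀ i, {τ : ℕ | ∃ x : List ((P.Vs i : Finset α) : Set α),
        (∀ v : ((P.Vs i : Finset α) : Set α), τ ≤ voteCount x v) ∧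
        Fi i x = ⟨P.root i, Finset.mem_coe.mpr (P.root_mem i)⟩}.Infinite)
    (hgmr : ∀ i, GMR (G.induce ((P.Vs i : Finset α) : Set α)) (Fi i)) :
    (∀ F : List α → α, IsFStar G P Fi F → Anonymous F ∧ ParetoOptimal G F) ∧
    (IsZVLineGraph P → ∀ F : List α → α, IsFStar G P Fi F → GMR G F) := by
  refine ⟨fun F hF => ⟨hF.anonymous hanon, hF.paretoOptimal hpo⟩, fun hline F hF => ?_⟩
  rintro ⟨n, x, C, A, hw, hs⟩
  by_cases hx : ∃ i, ∀ j, x j ∈ P.Vs i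
  · obtain ⟨i, hi⟩ := hx
    exact hF.not_manipulable_of_forall_mem hanon hτ hgmr hi hw hs
  · push Not at hx
    exact hF.not_manipulable_of_not_forall_mem
      (ZVPartition.quasiConvex_of_isZVLineGraph hline) hx hw hs
end
end

section
/- Let G = (𝒱, E) be a finite connected simple graph that is a ZV-line graph w.r.t. a ZV-ordered partition ⟨Z, V_1, …, V_k⟩. Then for every vertex v ∈ 𝒱 and every integer d ≥ 0, the set B(v,d) ∩ Z is an interval in Z. -/
/- Common framework: finite connected simple graphs, shortest-path distance,
   profiles as lists of vertices, mechanisms as functions `List α → α`,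
   anonymity, Pareto optimality, and group-manipulation-resistance. -/

open Classical

noncomputable section

theorem SimpleGraph.Connected.exists_adj_dist_eq_of_dist_eq_succ {α : Type} {G : SimpleGraph α}
    (hG : G.Connected) {v a : α} {d : ℕ} (h : G.dist v a = d + 1) :
    ∃ w, G.Adj w a ∧ G.dist v w = d := by
  obtain ⟨p, hp⟩ := hG.exists_walk_length_eq_dist a v
  rw [G.dist_comm, h] at hp
  cases p with
  | nil => simp at hp
  | @cons _ w _ haw q =>
    refine ⟨w, haw.symm, ?_⟩
    have h₁ : G.dist w v ≤ d := by
      have := SimpleGraph.dist_le q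
      simp only [SimpleGraph.Walk.length_cons] at hp
      omega
    have h₂ := hG.dist_triangle (u := v) (v := w) (w := a)
    rw [SimpleGraph.dist_eq_one_iff_adj.mpr haw.symm] at h₂
    rw [G.dist_comm] at h₁
    omega

/-- Order-convexity of a union follows if every point of the set lies in an interval inside the
set that meets a fixed interval inside the set. -/
theorem IsIntervalIn.of_forall_exists_meeting {α : Type} {ord : α → ℝ} {Z : Finset α}
    {A J : Set α} (hA : A ⊆ (Z : Set α)) (hJ : IsIntervalIn ord Z J) (hJA : J ⊆ A)
    (h : ∀ a ∈ A, ∃ I, IsIntervalIn ord Z I ∧ I ⊆ A ∧ a ∈ I ∧ (I ∩ J).Nonempty) :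
    IsIntervalIn ord Z A := by
  refine ⟨hA, fun a ha b hb c hc hac hcb => ?_⟩
  obtain ⟨I, hI, hIA, haI, p, hpI, hpJ⟩ := h a ha
  obtain ⟨K, hK, hKA, hbK, q, hqK, hqJ⟩ := h b hb
  rcases le_total (ord c) (ord p) with hcp | hpc
  · exact hIA (hI.2 a haI p hpI c hc hac hcp)
  rcases le_total (ord c) (ord q) with hcq | hqc
  · exact hJA (hJ.2 p hpJ q hqJ c hc hpc hcq)
  · exact hKA (hK.2 q hqK b hbK c hc hqc hcb)

namespace ZVPartition

variable {α : Type} {G : SimpleGraph α} (P : ZVPartition G)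

theorem eq_root_of_mem {z : α} (hz : z ∈ P.Z) {i : Fin P.k} (hi : z ∈ P.Vs i) :
    z = P.root i := by
  refine P.root_unique i z hi fun w _ => ?_
  have h : distToSet G z P.Z ≤ G.dist z z := Nat.sInf_le ⟨z, hz, rfl⟩
  rw [SimpleGraph.dist_self] at h
  exact h.trans (Nat.zero_le _)

theorem dist_eq_dist_root_add {i : Fin P.k} {u v : α} (hu : u ∈ P.Vs i) (hv : v ∉ P.Vs i) :
    G.dist v u = G.dist v (P.root i) + G.dist (P.root i) u := by
  refine le_antisymm P.hconn.dist_triangle ?_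
  obtain ⟨p, hp⟩ := P.hconn.exists_walk_length_eq_dist u v
  have hr := (P.separation i u hu v hv p).1
  have h := congrArg SimpleGraph.Walk.length (p.take_spec hr)
  rw [SimpleGraph.Walk.length_append, hp] at h
  have h₁ := SimpleGraph.dist_le (p.takeUntil _ hr)
  have h₂ := SimpleGraph.dist_le (p.dropUntil _ hr)
  rw [G.dist_comm (u := v), G.dist_comm (u := v), G.dist_comm (v := u)]
  omega

/-- The vertices that lie in `Z` or are the root of some part. -/
def IsPortal (v : α) : Prop := v ∈ P.Z ∨ ∃ i, v = P.root i

variable {P}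

theorem IsPortal.eq_root {v : α} (hv : P.IsPortal v) {i : Fin P.k} (hi : v ∈ P.Vs i) :
    v = P.root i := by
  rcases hv with hz | ⟨j, rfl⟩
  · exact P.eq_root_of_mem hz hi
  · by_cases hij : j = i
    · rw [hij]
    · exact absurd hi (Finset.disjoint_left.mp (P.Vs_disjoint j i hij) (P.root_mem j))

theorem IsPortal.dist_root_le {v : α} (hv : P.IsPortal v) {i : Fin P.k} {u : α}
    (hu : u ∈ P.Vs i) : G.dist v (P.root i) ≤ G.dist v u := by
  by_cases hvi : v ∈ P.Vs i
  · rw [hv.eq_root hvi, SimpleGraph.dist_self]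
    exact Nat.zero_le _
  · rw [P.dist_eq_dist_root_add hu hvi]
    exact Nat.le_add_right _ _

/-- The penultimate vertex on a geodesic from a portal to a vertex of `Z` is a portal. -/
theorem IsPortal.of_adj {v w a : α} (hv : P.IsPortal v) (ha : a ∈ P.Z) (hwa : G.Adj w a)
    (hlt : G.dist v w < G.dist v a) : P.IsPortal w := by
  rcases P.cover w with hw | ⟨i, hi⟩
  · exact Or.inl hw
  refine Or.inr ⟨i, ?_⟩
  by_cases hai : a ∈ P.Vs i
  · have h := hv.dist_root_le hi
    rw [← P.eq_root_of_mem ha hai] at h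
    omega
  · have h := (P.separation i w hi a hai hwa.toWalk).1
    simp only [SimpleGraph.Walk.support_cons, SimpleGraph.Walk.support_nil,
      List.mem_cons, List.not_mem_nil, or_false] at h
    rcases h with h | h
    · exact h.symm
    · exact absurd (h ▸ P.root_mem i) hai

/-- The penultimate vertex on a geodesic from a portal to a root outside `Z` lies in `Z`. -/
theorem IsPortal.mem_of_adj_root {v p : α} {i : Fin P.k} (hv : P.IsPortal v)
    (hr : P.root i ∉ P.Z) (hp : G.Adj p (P.root i))
    (hlt : G.dist v p < G.dist v (P.root i)) : p ∈ P.Z := by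
  have hpi : p ∉ P.Vs i := fun h => absurd (hv.dist_root_le h) (by omega)
  obtain ⟨z, hz, hzs⟩ := (P.separation i _ (P.root_mem i) p hpi hp.symm.toWalk).2
  simp only [SimpleGraph.Walk.support_cons, SimpleGraph.Walk.support_nil,
    List.mem_cons, List.not_mem_nil, or_false] at hzs
  rcases hzs with rfl | rfl
  · exact absurd hz hr
  · exact hz

theorem isIntervalIn_ball_of_isPortal
    (h : ∀ w, P.IsPortal w → IsIntervalIn P.ord P.Z (ball G w 1 ∩ (P.Z : Set α)))
    {v : α} (hv : P.IsPortal v) (d : ℕ) :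
    IsIntervalIn P.ord P.Z (ball G v d ∩ (P.Z : Set α)) := by
  induction d with
  | zero =>
    refine ⟨Set.inter_subset_right, ?_⟩
    rintro a ⟨ha, haZ⟩ b ⟨hb, -⟩ c hc hac hcb
    have hva : v = a := P.hconn.dist_eq_zero_iff.mp (Nat.le_zero.mp ha)
    have hvb : v = b := P.hconn.dist_eq_zero_iff.mp (Nat.le_zero.mp hb)
    subst hva hvb
    rw [P.ord_inj hc haZ (le_antisymm hcb hac)]
    exact ⟨ha, haZ⟩
  | succ d ih =>
    rcases Nat.eq_zero_or_pos d with rfl | hd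
    · exact h v hv
    have hsub : ball G v d ∩ (P.Z : Set α) ⊆ ball G v (d + 1) ∩ (P.Z : Set α) :=
      fun u hu => ⟨Nat.le_succ_of_le hu.1, hu.2⟩
    refine .of_forall_exists_meeting Set.inter_subset_right ih hsub ?_
    rintro a ⟨had, haZ⟩
    rcases Nat.le_succ_iff.mp had with hle | heq
    · exact ⟨_, ih, hsub, ⟨hle, haZ⟩, a, ⟨hle, haZ⟩, hle, haZ⟩
    obtain ⟨w, hwa, hw⟩ := P.hconn.exists_adj_dist_eq_of_dist_eq_succ heq
    have hwP : P.IsPortal w := hv.of_adj haZ hwa (by omega)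
    have hsub' : ball G w 1 ∩ (P.Z : Set α) ⊆ ball G v (d + 1) ∩ (P.Z : Set α) := by
      rintro u ⟨hu, huZ⟩
      refine ⟨P.hconn.dist_triangle.trans (?_ : G.dist v w + G.dist w u ≤ d + 1), huZ⟩
      rw [hw]
      exact Nat.add_le_add_left hu d
    refine ⟨_, h w hwP, hsub', ⟨(SimpleGraph.dist_eq_one_iff_adj.mpr hwa).le, haZ⟩, ?_⟩
    by_cases hwZ : w ∈ P.Z
    · exact ⟨w, ⟨by simp [ball], hwZ⟩, hw.le, hwZ⟩
    obtain ⟨i, rfl⟩ := hwP.resolve_left hwZ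
    obtain ⟨e, rfl⟩ := Nat.exists_eq_succ_of_ne_zero hd.ne'
    obtain ⟨p, hpw, hp⟩ := P.hconn.exists_adj_dist_eq_of_dist_eq_succ hw
    have hpZ : p ∈ P.Z := hv.mem_of_adj_root hwZ hpw (by omega)
    exact ⟨p, ⟨(SimpleGraph.dist_eq_one_iff_adj.mpr hpw.symm).le, hpZ⟩,
      hp.le.trans (Nat.le_succ e), hpZ⟩

theorem dist_eq_dist_root_add_of_mem {i : Fin P.k} {v z : α} (hv : v ∈ P.Vs i) (hz : z ∈ P.Z) :
    G.dist v z = G.dist v (P.root i) + G.dist (P.root i) z := by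
  by_cases hzi : z ∈ P.Vs i
  · rw [← P.eq_root_of_mem hz hzi, SimpleGraph.dist_self, Nat.add_zero]
  · rw [G.dist_comm, P.dist_eq_dist_root_add hv hzi, Nat.add_comm, G.dist_comm,
      G.dist_comm (u := z)]

end ZVPartition

/-- In a finite connected ZV-line graph, every ball intersects
`Z` in an interval of `Z`. -/
theorem ball_inter_Z_isInterval
    {α : Type} [Fintype α] (G : SimpleGraph α) (P : ZVPartition G)
    (hZV : IsZVLineGraph P) :
    ∀ (v : α) (d : ℕ), IsIntervalIn P.ord P.Z (ball G v d ∩ (P.Z : Set α)) := by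
  intro v d
  have h : ∀ w, P.IsPortal w → IsIntervalIn P.ord P.Z (ball G w 1 ∩ (P.Z : Set α)) := by
    cases hZV with
    | mk _ hb _ _ _ hballroot =>
      rintro w (hw | ⟨i, rfl⟩)
      · exact hb w hw
      · exact hballroot i
  rcases P.cover v with hv | ⟨i, hi⟩
  · exact ZVPartition.isIntervalIn_ball_of_isPortal h (Or.inl hv) d
  have hroot := fun e => ZVPartition.isIntervalIn_ball_of_isPortal h (Or.inr ⟨i, rfl⟩) e
  refine ⟨Set.inter_subset_right, ?_⟩
  rintro a ⟨ha, haZ⟩ b ⟨hb, hbZ⟩ c hc hac hcb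
  simp only [ball, Set.mem_ofPred_eq] at ha hb
  rw [ZVPartition.dist_eq_dist_root_add_of_mem hi haZ] at ha
  rw [ZVPartition.dist_eq_dist_root_add_of_mem hi hbZ] at hb
  have hcr := ((hroot (d - G.dist v (P.root i))).2 a ⟨Nat.le_sub_of_add_le' ha, haZ⟩
    b ⟨Nat.le_sub_of_add_le' hb, hbZ⟩ c hc hac hcb).1
  refine ⟨?_, hc⟩
  simp only [ball, Set.mem_ofPred_eq] at hcr ⊢
  rw [ZVPartition.dist_eq_dist_root_add_of_mem hi hc]
  omega
end
end
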